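/- There exists a constant C > 0 such that the following holds. Let G = (V,E) be a finite strongly connected directed graph on n ≥ 2 vertices and set φ' = min(φ_out(G), φ_in(G)). For every valuation f : V → {1,…,n} whose strong cycle set C_f is nonempty, the expected number of rounds of the asynchronous maximum model started from f until the strong cycle set equals all of V is at most C·(n/φ')·log n. -/

import Mathlib

open MeasureTheory
open scoped ENNReal

attribute [local instance] Classical.propDecidable

/-- The out-neighbours of `v` in the directed graph with edge relation `E`, as a finset. -/
noncomputable def outNbrs {V : Type*} [Fintype V] (E : V → V → Prop) (v : V) : Finset V :=
  Finset.univ.filter (fun u => E v u)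

/-- The asynchronous maximum update of a valuation `f` at the vertex `v` in a directed graph:
the value at `v` is replaced by the maximum of `f` over the out-neighbours of `v` (if `v` has
at least one out-neighbour; otherwise nothing changes), and all other values are unchanged. -/
noncomputable def dUpdate {V : Type*} [Fintype V] (E : V → V → Prop)
    (f : V → ℕ) (v : V) : V → ℕ :=
  fun u => if u = v ∧ (outNbrs E v).Nonempty then (outNbrs E v).sup f else f u

/-- The asynchronous maximum model on a directed graph: starting from the valuation `f`, at
round `t` the vertex `ω t` is chosen and updated.  `dRun E f ω t` is the valuation after `t`
rounds. -/
noncomputable def dRun {V : Type*} [Fintype V] (E : V → V → Prop)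
    (f : V → ℕ) (ω : ℕ → V) : ℕ → V → ℕ
  | 0 => f
  | (t + 1) => dUpdate E (dRun E f ω t) (ω t)

/-- `μ` is the infinite product of uniform measures on `V`: a probability measure on `ℕ → V`
under which the coordinates are independent and uniformly distributed on `V`, i.e. every
cylinder fixing the first `m` coordinates has measure `(1/|V|)^m`. -/
def IsUniformProduct {V : Type*} [Fintype V] [MeasurableSpace V]
    (μ : Measure (ℕ → V)) : Prop :=
  IsProbabilityMeasure μ ∧
    ∀ (m : ℕ) (g : ℕ → V),
      μ {ω | ∀ i < m, ω i = g i} = (1 / (Fintype.card V : ℝ≥0∞)) ^ m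

/-- `x` lies on a strong cycle of the valuation `f`: a directed cycle (a nonempty list of
distinct vertices `v :: l` with an edge between consecutive vertices and an edge from the
last back to `v`) all of whose vertices carry the maximum value `M_f = max_v f v`. -/
def onStrongCycle {V : Type*} [Fintype V] (E : V → V → Prop) (f : V → ℕ) (x : V) : Prop :=
  ∃ (v : V) (l : List V), (v :: l).Nodup ∧ List.Chain E v (l ++ [v]) ∧
    (∀ u ∈ v :: l, f u = Finset.univ.sup f) ∧ x ∈ v :: l

/-- The strong cycle set `C_f`: all vertices `x` that either lie on a strong cycle, or admit a
directed walk, all of whose vertices carry the maximum value `M_f`, to a vertex of a strong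
cycle. -/
def strongCycleSet {V : Type*} [Fintype V] (E : V → V → Prop) (f : V → ℕ) : Set V :=
  {x | f x = Finset.univ.sup f ∧ ∃ w, onStrongCycle E f w ∧
    Relation.ReflTransGen (fun a b => E a b ∧ f b = Finset.univ.sup f) x w}

/-- The out-boundary of a finset `A` in a directed graph with edge relation `E`:
the vertices outside `A` receiving an edge from `A`. -/
noncomputable def outBoundary {V : Type*} [Fintype V] (E : V → V → Prop)
    (A : Finset V) : Finset V :=
  Finset.univ.filter (fun v => v ∉ A ∧ ∃ u ∈ A, E u v)

/-- The outward vertex expansion `φ_out(G)`: the minimum of `|Γ(A)|/|A|` over all nonempty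
vertex sets `A` with `|A| ≤ n/2`. -/
noncomputable def phiOut {V : Type*} [Fintype V] (E : V → V → Prop) : ℝ :=
  sInf {r : ℝ | ∃ A : Finset V, A.Nonempty ∧ 2 * A.card ≤ Fintype.card V ∧
    r = (outBoundary E A).card / A.card}

/-- The inward vertex expansion `φ_in(G)`: the outward vertex expansion of the graph obtained
by reversing every edge. -/
noncomputable def phiIn {V : Type*} [Fintype V] (E : V → V → Prop) : ℝ :=
  phiOut (fun a b => E b a)

/-- The number of rounds, along the update sequence `ω`, until the strong cycle set of the
current valuation is all of `V` (`∞` if this never happens), as a value in `ℝ≥0∞`. -/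
noncomputable def fullCycleSetTime {V : Type*} [Fintype V] (E : V → V → Prop)
    (f : V → ℕ) (ω : ℕ → V) : ℝ≥0∞ :=
  ⨅ (t : ℕ) (_ : strongCycleSet E (dRun E f ω t) = Set.univ), (t : ℝ≥0∞)



section StrongCycleSet

variable {V : Type*} [Fintype V] {E : V → V → Prop}

theorem le_univ_sup (g : V → ℕ) (x : V) : g x ≤ Finset.univ.sup g :=
  Finset.le_sup (Finset.mem_univ x)

/-- Every periodic point of a self-map following edges between vertices of maximum value lies on
a strong cycle. -/
theorem onStrongCycle_of_mem_periodicPts {g : V → ℕ} {nxt : V → V} {w : V}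
    (hw : w ∈ Function.periodicPts nxt)
    (hE : ∀ i, E (nxt^[i] w) (nxt^[i + 1] w))
    (hM : ∀ i, g (nxt^[i] w) = Finset.univ.sup g) : onStrongCycle E g w := by
  have hpos := Function.minimalPeriod_pos_of_mem_periodicPts hw
  obtain ⟨p, hp⟩ := Nat.exists_eq_succ_of_ne_zero hpos.ne'
  have hcons : w :: (List.range p).map (fun i => nxt^[i + 1] w) =
      (List.range (p + 1)).map (fun i => nxt^[i] w) := by
    simp [List.range_succ_eq_map, Function.comp_def]
  have hnxt : nxt^[p + 1] w = w := by
    have := Function.iterate_minimalPeriod (f := nxt) (x := w)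
    rwa [hp] at this
  have hfull : w :: ((List.range p).map (fun i => nxt^[i + 1] w) ++ [w]) =
      (List.range (p + 2)).map (fun i => nxt^[i] w) := by
    rw [← List.cons_append, hcons, List.range_succ (n := p + 1), List.map_append]
    simp only [List.map_cons, List.map_nil, hnxt]
  refine ⟨w, (List.range p).map (fun i => nxt^[i + 1] w), ?_, ?_, ?_, by simp⟩
  · have := Function.nodup_periodicOrbit (f := nxt) (x := w)
    rw [Function.periodicOrbit_def, Cycle.nodup_coe_iff, hp] at this
    rwa [hcons]
  · change List.IsChain E (w :: ((List.range p).map (fun i => nxt^[i + 1] w) ++ [w]))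
    rw [hfull, List.isChain_map, List.isChain_range]
    exact fun i _ => hE i
  · rw [hcons]
    intro u hu
    obtain ⟨i, -, rfl⟩ := List.mem_map.1 hu
    exact hM i

/-- A set of vertices of maximum value in which every vertex has an out-neighbour is contained in
the strong cycle set. -/
theorem subset_strongCycleSet {g : V → ℕ} {S : Set V}
    (hM : ∀ x ∈ S, g x = Finset.univ.sup g) (hS : ∀ x ∈ S, ∃ y ∈ S, E x y) :
    S ⊆ strongCycleSet E g := by
  intro x hx
  have hex : ∀ x, ∃ y, x ∈ S → y ∈ S ∧ E x y := fun x => by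
    by_cases h : x ∈ S
    · obtain ⟨y, hy, hxy⟩ := hS x h
      exact ⟨y, fun _ => ⟨hy, hxy⟩⟩
    · exact ⟨x, fun h' => absurd h' h⟩
  choose nxt hnxt using hex
  have hmem : ∀ i, nxt^[i] x ∈ S := fun i => by
    induction i with
    | zero => exact hx
    | succ i ih => rw [Function.iterate_succ_apply']; exact (hnxt _ ih).1
  have hedge : ∀ i, E (nxt^[i] x) (nxt^[i + 1] x) := fun i => by
    rw [Function.iterate_succ_apply']; exact (hnxt _ (hmem i)).2
  have hreach : ∀ i, Relation.ReflTransGen (fun a b => E a b ∧ g b = Finset.univ.sup g) x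
      (nxt^[i] x) := fun i => by
    induction i with
    | zero => exact .refl
    | succ i ih => exact ih.tail ⟨hedge i, hM _ (hmem _)⟩
  obtain ⟨i, j, hij, heq⟩ : ∃ i j, i < j ∧ nxt^[i] x = nxt^[j] x := by
    obtain ⟨i, j, hne, heq⟩ := Finite.exists_ne_map_eq_of_infinite (fun i : ℕ => nxt^[i] x)
    rcases hne.lt_or_gt with h | h
    · exact ⟨i, j, h, heq⟩
    · exact ⟨j, i, h, heq.symm⟩
  refine ⟨hM x hx, nxt^[i] x, onStrongCycle_of_mem_periodicPts (nxt := nxt) ?_ ?_ ?_, hreach i⟩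
  · refine ⟨j - i, Nat.sub_pos_of_lt hij, ?_⟩
    rw [Function.IsPeriodicPt, Function.IsFixedPt, ← Function.iterate_add_apply,
      Nat.sub_add_cancel hij.le, heq]
  · intro k
    rw [← Function.iterate_add_apply, ← Function.iterate_add_apply, add_right_comm]
    exact hedge _
  · intro k
    rw [← Function.iterate_add_apply]
    exact hM _ (hmem _)

/-- Every vertex of the strong cycle set has an out-neighbour in the strong cycle set. -/
theorem exists_edge_of_mem_strongCycleSet {g : V → ℕ} {x : V} (hx : x ∈ strongCycleSet E g) :
    ∃ y ∈ strongCycleSet E g, E x y := by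
  obtain ⟨hxM, w, hw, hreach⟩ := hx
  rcases hreach.cases_head with rfl | ⟨b, ⟨hxb, hb⟩, hbw⟩
  · obtain ⟨v, l, hnd, hch, hM, hmem⟩ := hw
    obtain ⟨s, t, hst⟩ := List.append_of_mem hmem
    obtain ⟨y, t', hyt⟩ : ∃ y t', t ++ [v] = y :: t' := by cases t <;> simp
    have hch' : List.IsChain E (v :: (l ++ [v])) := hch
    rw [← List.cons_append, hst, List.append_assoc, List.cons_append, hyt,
      List.isChain_append_cons_cons] at hch'
    have hy : y ∈ v :: l := by
      have : y ∈ t ++ [v] := by simp [hyt]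
      rcases List.mem_append.1 this with h | h
      · rw [hst]; simp [h]
      · rw [List.mem_singleton.1 h]
        exact List.mem_cons_self
    exact ⟨y, ⟨hM y hy, y, ⟨v, l, hnd, hch, hM, hy⟩, .refl⟩, hch'.2.1⟩
  · exact ⟨b, ⟨hb, w, hw, hbw⟩, hxb⟩

theorem dUpdate_of_ne (g : V → ℕ) {u v : V} (h : u ≠ v) : dUpdate E g v u = g u := by
  simp [dUpdate, h]

theorem dUpdate_le_sup (g : V → ℕ) (v u : V) : dUpdate E g v u ≤ Finset.univ.sup g := by
  unfold dUpdate
  split_ifs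
  · exact Finset.sup_mono (Finset.subset_univ _)
  · exact le_univ_sup g u

theorem dUpdate_eq_sup_of_edge {g : V → ℕ} {v y : V} (hE : E v y)
    (hy : g y = Finset.univ.sup g) : dUpdate E g v v = Finset.univ.sup g := by
  have hmem : y ∈ outNbrs E v := by simp [outNbrs, hE]
  refine le_antisymm (dUpdate_le_sup g v v) ?_
  unfold dUpdate
  rw [if_pos ⟨rfl, y, hmem⟩, ← hy]
  exact Finset.le_sup hmem

/-- After updating a vertex, the strong cycle set contains the old one together with the updated
vertex if that vertex has an out-neighbour in the old strong cycle set. -/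
theorem strongCycleSet_dUpdate {g : V → ℕ} (v : V) :
    strongCycleSet E g ∪ {u | u = v ∧ ∃ y ∈ strongCycleSet E g, E u y} ⊆
      strongCycleSet E (dUpdate E g v) := by
  have hval : ∀ x ∈ strongCycleSet E g ∪ {u | u = v ∧ ∃ y ∈ strongCycleSet E g, E u y},
      dUpdate E g v x = Finset.univ.sup g := by
    intro x hx
    by_cases hxv : x = v
    · subst hxv
      obtain ⟨y, hy, hxy⟩ : ∃ y ∈ strongCycleSet E g, E x y :=
        hx.elim exists_edge_of_mem_strongCycleSet fun h => h.2
      exact dUpdate_eq_sup_of_edge hxy hy.1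
    · rw [dUpdate_of_ne g hxv]
      rcases hx with hx | hx
      · exact hx.1
      · exact absurd hx.1 hxv
  refine subset_strongCycleSet (fun x hx => ?_) fun x hx => ?_
  · refine le_antisymm (le_univ_sup _ x) (Finset.sup_le fun u _ => ?_)
    rw [hval x hx]
    exact dUpdate_le_sup g v u
  · obtain ⟨y, hy, hxy⟩ : ∃ y ∈ strongCycleSet E g, E x y :=
      hx.elim exists_edge_of_mem_strongCycleSet fun h => h.2
    exact ⟨y, Or.inl hy, hxy⟩

end StrongCycleSet

section Expansion

variable {V : Type*} [Fintype V] {E : V → V → Prop}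

theorem phiOut_nonneg : 0 ≤ phiOut E := by
  refine Real.sInf_nonneg ?_
  rintro r ⟨A, -, -, rfl⟩
  positivity

theorem phiOut_mul_card_le {A : Finset V} (hA : 2 * A.card ≤ Fintype.card V) :
    phiOut E * A.card ≤ (outBoundary E A).card := by
  rcases A.eq_empty_or_nonempty with rfl | hne
  · simp
  have hpos : (0 : ℝ) < A.card := by exact_mod_cast hne.card_pos
  rw [← le_div_iff₀ hpos]
  refine csInf_le ⟨0, ?_⟩ ⟨A, hne, hA, rfl⟩
  rintro r ⟨B, -, -, rfl⟩
  positivity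

theorem outBoundary_nonempty (hE : ∀ u v : V, Relation.ReflTransGen E u v) {A : Finset V}
    (hA : A.Nonempty) (hA' : A ≠ Finset.univ) : (outBoundary E A).Nonempty := by
  by_contra hempty
  obtain ⟨a, ha⟩ := hA
  refine hA' (Finset.eq_univ_iff_forall.2 fun v => ?_)
  induction hE a v with
  | refl => exact ha
  | @tail b c _ hbc ih =>
    by_contra hc
    exact hempty ⟨c, by simpa [outBoundary] using ⟨hc, b, ih, hbc⟩⟩

theorem exists_finset_card_half (V : Type*) [Fintype V] :
    ∃ A : Finset V, A.card = Fintype.card V / 2 := by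
  obtain ⟨A, -, hA⟩ := Finset.exists_subset_card_eq
    (s := (Finset.univ : Finset V)) (n := Fintype.card V / 2)
    (by rw [Finset.card_univ]; exact Nat.div_le_self _ _)
  exact ⟨A, hA⟩

theorem phiOut_pos (hV : 2 ≤ Fintype.card V) (hE : ∀ u v : V, Relation.ReflTransGen E u v) :
    0 < phiOut E := by
  have hn : (0 : ℝ) < Fintype.card V := by exact_mod_cast (by omega : 0 < Fintype.card V)
  refine lt_of_lt_of_le (one_div_pos.2 hn) (le_csInf ?_ ?_)
  · obtain ⟨A, hA⟩ := exists_finset_card_half V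
    exact ⟨_, A, Finset.card_pos.1 (by omega), by omega, rfl⟩
  · rintro r ⟨A, hne, hA, rfl⟩
    have hA' : A ≠ Finset.univ := by
      rintro rfl
      rw [Finset.card_univ] at hA
      omega
    have hpos : (0 : ℝ) < A.card := by exact_mod_cast hne.card_pos
    have h1 : (1 : ℝ) ≤ (outBoundary E A).card := by
      exact_mod_cast (outBoundary_nonempty hE hne hA').card_pos
    have h2 : (A.card : ℝ) ≤ Fintype.card V := by exact_mod_cast A.card_le_univ
    exact div_le_div₀ (by positivity) h1 hpos h2

theorem phiOut_le_two (hV : 2 ≤ Fintype.card V) : phiOut E ≤ 2 := by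
  obtain ⟨A, hA⟩ := exists_finset_card_half V
  have h := phiOut_mul_card_le (E := E) (A := A) (by omega)
  have hsub : outBoundary E A ⊆ Finset.univ \ A := by
    intro v hv
    simp only [outBoundary, Finset.mem_filter] at hv
    simp [hv.2.1]
  have hcard := Finset.card_le_card hsub
  rw [Finset.card_sdiff_of_subset (Finset.subset_univ _), Finset.card_univ] at hcard
  have hle : ((outBoundary E A).card : ℝ) ≤ 2 * A.card := by
    exact_mod_cast (by omega : (outBoundary E A).card ≤ 2 * A.card)
  have hpos : (0 : ℝ) < A.card := by exact_mod_cast (by omega : 0 < A.card)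
  exact le_of_mul_le_mul_right (h.trans hle) hpos

/-- The in-boundary of any vertex set `A` is large in terms of both expansions and the smaller of
`A` and its complement. -/
theorem min_phi_mul_min_card_le (hV : 2 ≤ Fintype.card V) (A : Finset V) :
    min (phiOut E) (phiIn E) * (min A.card (Fintype.card V - A.card) : ℕ) ≤
      3 * (outBoundary (fun a b => E b a) A).card := by
  set φ := min (phiOut E) (phiIn E) with hφ
  set Γ := outBoundary (fun a b => E b a) A with hΓ
  have hφ0 : 0 ≤ φ := le_min phiOut_nonneg phiOut_nonneg
  have hφ2 : φ ≤ 2 := (min_le_left _ _).trans (phiOut_le_two hV)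
  by_cases hA : 2 * A.card ≤ Fintype.card V
  · have h := phiOut_mul_card_le (E := fun a b => E b a) hA
    have h1 : φ * (min A.card (Fintype.card V - A.card) : ℕ) ≤ φ * A.card := by
      gcongr
      exact min_le_left _ _
    have h2 : φ * A.card ≤ phiIn E * A.card := by
      gcongr
      exact min_le_right _ _
    have h3 : (0 : ℝ) ≤ Γ.card := by positivity
    have h4 : phiIn E * A.card ≤ Γ.card := h
    linarith
  · set B := Finset.univ \ (A ∪ Γ) with hB
    have hdisj : Disjoint A Γ := by
      rw [Finset.disjoint_right]
      intro v hv
      exact (Finset.mem_filter.1 hv).2.1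
    have hBcard : Fintype.card V = B.card + (A.card + Γ.card) := by
      rw [← Finset.card_union_of_disjoint hdisj, hB,
        Finset.card_sdiff_add_card_eq_card (Finset.subset_univ _), Finset.card_univ]
    have hsub : outBoundary E B ⊆ Γ := by
      intro v hv
      obtain ⟨hvB, u, hu, huv⟩ := (Finset.mem_filter.1 hv).2
      simp only [hB, Finset.mem_sdiff, Finset.mem_univ, true_and, Finset.mem_union, not_or,
        not_and, not_not] at hvB hu
      by_contra hvΓ
      have hvA : v ∈ A := by
        by_contra hvA
        exact hvΓ (by tauto)
      refine hu.2 ?_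
      rw [hΓ, outBoundary, Finset.mem_filter]
      exact ⟨Finset.mem_univ _, hu.1, v, hvA, huv⟩
    have h1 := phiOut_mul_card_le (E := E) (A := B) (by omega)
    have h2 : ((outBoundary E B).card : ℝ) ≤ Γ.card := by
      exact_mod_cast Finset.card_le_card hsub
    have h3 : φ * B.card ≤ phiOut E * B.card := by
      gcongr
      exact min_le_left _ _
    have h4 : φ * (min A.card (Fintype.card V - A.card) : ℕ) ≤ φ * (B.card + Γ.card) := by
      gcongr
      exact_mod_cast (min_le_right _ _).trans (by omega)
    have h5 : φ * Γ.card ≤ 2 * Γ.card := by gcongr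
    linarith

end Expansion

section UniformProduct

variable {V : Type*} [Fintype V] [MeasurableSpace V] [MeasurableSingletonClass V]

/-- Extension of a finite sequence to an infinite one by a constant value. -/
def extendSeq {V : Type*} (d : V) {m : ℕ} (w : Fin m → V) : ℕ → V :=
  fun i => if h : i < m then w ⟨i, h⟩ else d

theorem extendSeq_of_lt {V : Type*} (d : V) {m : ℕ} (w : Fin m → V) {i : ℕ} (h : i < m) :
    extendSeq d w i = w ⟨i, h⟩ := dif_pos h

/-- A function of sequences depending only on the first `m` entries factors through the
restriction to these entries. -/
theorem eq_comp_extendSeq {V α : Type*} (d : V) {m : ℕ} {X : (ℕ → V) → α}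
    (hX : ∀ ω ω' : ℕ → V, (∀ i < m, ω i = ω' i) → X ω = X ω') :
    X = (fun w : Fin m → V => X (extendSeq d w)) ∘ fun ω i => ω i := by
  ext1 ω
  exact hX _ _ fun i hi => (extendSeq_of_lt d (fun i : Fin m => ω i) hi).symm

theorem measurable_restrict_fin {V : Type*} [MeasurableSpace V] (m : ℕ) :
    Measurable fun (ω : ℕ → V) (i : Fin m) => ω i :=
  measurable_pi_lambda _ fun i => measurable_pi_apply (i : ℕ)

theorem measurable_of_eq_on_initial [Nonempty V] {m : ℕ} {X : (ℕ → V) → ℝ≥0∞}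
    (hX : ∀ ω ω' : ℕ → V, (∀ i < m, ω i = ω' i) → X ω = X ω') : Measurable X := by
  rw [eq_comp_extendSeq (Classical.arbitrary V) hX]
  exact (Measurable.of_discrete).comp (measurable_restrict_fin m)

theorem lintegral_of_eq_on_initial {μ : Measure (ℕ → V)} (hμ : IsUniformProduct μ) (d : V)
    {m : ℕ} {X : (ℕ → V) → ℝ≥0∞}
    (hX : ∀ ω ω' : ℕ → V, (∀ i < m, ω i = ω' i) → X ω = X ω') :
    ∫⁻ ω, X ω ∂μ =
      ∑ w : Fin m → V, X (extendSeq d w) * (1 / (Fintype.card V : ℝ≥0∞)) ^ m := by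
  have hmap := lintegral_map (μ := μ) (f := fun w : Fin m → V => X (extendSeq d w))
    Measurable.of_discrete (measurable_restrict_fin m)
  conv_lhs => rw [eq_comp_extendSeq d hX]
  refine hmap.symm.trans ?_
  rw [lintegral_fintype]
  refine Finset.sum_congr rfl fun w _ => ?_
  rw [Measure.map_apply (measurable_restrict_fin m) (measurableSet_singleton w),
    ← hμ.2 m (extendSeq d w)]
  congr 2
  ext ω
  simp only [Set.mem_preimage, Set.mem_singleton_iff, Set.mem_ofPred_eq, funext_iff]
  constructor
  · intro h i hi
    rw [extendSeq_of_lt d w hi, ← h]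
  · intro h i
    rw [h i i.2, extendSeq_of_lt d w i.2]

theorem dRun_congr {V : Type*} [Fintype V] {E : V → V → Prop} {f : V → ℕ} {ω ω' : ℕ → V}
    {m : ℕ} (h : ∀ i < m, ω i = ω' i) : dRun E f ω m = dRun E f ω' m := by
  induction m with
  | zero => rfl
  | succ m ih =>
    simp only [dRun]
    rw [ih fun i hi => h i (by omega), h m (by omega)]

/-- The Markov property: the expectation of a function of the state after `m + 1` rounds is
obtained by averaging over the vertex updated in the last round. -/
theorem lintegral_dRun_succ {μ : Measure (ℕ → V)} (hμ : IsUniformProduct μ) [Nonempty V]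
    (E : V → V → Prop) (f : V → ℕ) (W : (V → ℕ) → ℝ≥0∞) (m : ℕ) :
    ∫⁻ ω, W (dRun E f ω (m + 1)) ∂μ =
      ∫⁻ ω, (∑ v, W (dUpdate E (dRun E f ω m) v)) * (1 / (Fintype.card V : ℝ≥0∞)) ∂μ := by
  have d : V := Classical.arbitrary V
  rw [lintegral_of_eq_on_initial hμ d fun ω ω' h => by rw [dRun_congr h],
    lintegral_of_eq_on_initial (m := m) hμ d fun ω ω' h => by rw [dRun_congr h],
    ← (Fin.snocEquiv fun _ : Fin (m + 1) => V).sum_comp, Fintype.sum_prod_type_right]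
  refine Finset.sum_congr rfl fun w _ => ?_
  rw [Finset.sum_mul, Finset.sum_mul]
  refine Finset.sum_congr rfl fun v _ => ?_
  rw [mul_assoc, ← pow_succ']
  congr 2
  change dUpdate E (dRun E f _ m) (extendSeq d _ m) = _
  congr 1
  · refine dRun_congr fun i hi => ?_
    rw [extendSeq_of_lt d _ hi, extendSeq_of_lt d _ (Nat.lt_succ_of_lt hi)]
    exact Fin.snoc_castSucc (α := fun _ => V) v w ⟨i, hi⟩
  · rw [extendSeq_of_lt d _ (Nat.lt_succ_self m)]
    exact Fin.snoc_last (α := fun _ => V) v w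

theorem fullCycleSetTime_le_tsum {V : Type*} [Fintype V] (E : V → V → Prop) (f : V → ℕ)
    (ω : ℕ → V) :
    fullCycleSetTime E f ω ≤
      ∑' t, if strongCycleSet E (dRun E f ω t) = Set.univ then 0 else (1 : ℝ≥0∞) := by
  by_cases h : ∃ t, strongCycleSet E (dRun E f ω t) = Set.univ
  · calc fullCycleSetTime E f ω ≤ (Nat.find h : ℝ≥0∞) :=
        iInf₂_le (f := fun (t : ℕ) (_ : strongCycleSet E (dRun E f ω t) = Set.univ) =>
          (t : ℝ≥0∞)) _ (Nat.find_spec h)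
      _ = ∑ t ∈ Finset.range (Nat.find h),
          if strongCycleSet E (dRun E f ω t) = Set.univ then 0 else (1 : ℝ≥0∞) := by
        rw [Finset.sum_congr rfl fun t ht =>
          if_neg (Nat.find_min h (Finset.mem_range.1 ht))]
        simp
      _ ≤ _ := ENNReal.sum_le_tsum _
  · push Not at h
    simp [h]

/-- A potential decreasing in expectation by at least one in every round in which the strong
cycle set is not full bounds the expected time until it is full. -/
theorem lintegral_fullCycleSetTime_le_of_drift {μ : Measure (ℕ → V)} (hμ : IsUniformProduct μ)
    [Nonempty V] {E : V → V → Prop} (W : (V → ℕ) → ℝ≥0∞)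
    (hW : ∀ g, (∑ v, W (dUpdate E g v)) * (1 / (Fintype.card V : ℝ≥0∞)) +
      (if strongCycleSet E g = Set.univ then 0 else 1) ≤ W g) (f : V → ℕ) :
    ∫⁻ ω, fullCycleSetTime E f ω ∂μ ≤ W f := by
  have hprob : IsProbabilityMeasure μ := hμ.1
  have hmeas : ∀ (F : (V → ℕ) → ℝ≥0∞) (t : ℕ), Measurable fun ω => F (dRun E f ω t) :=
    fun F t => measurable_of_eq_on_initial (m := t) fun ω ω' h => by rw [dRun_congr h]
  set I : (V → ℕ) → ℝ≥0∞ := fun g => if strongCycleSet E g = Set.univ then 0 else 1 with hI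
  have hpartial : ∀ m, ∫⁻ ω, W (dRun E f ω m) ∂μ +
      ∑ t ∈ Finset.range m, ∫⁻ ω, I (dRun E f ω t) ∂μ ≤ W f := by
    intro m
    induction m with
    | zero => simp [dRun]
    | succ m ih =>
      refine le_trans ?_ ih
      rw [Finset.sum_range_succ, add_comm (∑ t ∈ _, _), ← add_assoc, lintegral_dRun_succ hμ,
        ← lintegral_add_right _ (hmeas I m)]
      gcongr with ω
      exact hW _
  calc ∫⁻ ω, fullCycleSetTime E f ω ∂μ ≤ ∫⁻ ω, ∑' t, I (dRun E f ω t) ∂μ :=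
        lintegral_mono fun ω => fullCycleSetTime_le_tsum E f ω
    _ = ∑' t, ∫⁻ ω, I (dRun E f ω t) ∂μ :=
        lintegral_tsum fun t => (hmeas I t).aemeasurable
    _ ≤ W f := by
        rw [ENNReal.tsum_eq_iSup_nat]
        exact iSup_le fun m => le_add_self.trans (hpartial m)

end UniformProduct

section Potential

/-- The potential of a strong cycle set with `k` out of `n` vertices: a sum of upper bounds for
the expected times until a set of `j` vertices grows. -/
noncomputable def growthPotential (c : ℝ≥0∞) (n k : ℕ) : ℝ≥0∞ :=
  ∑ j ∈ Finset.Ico k n, c / (min j (n - j) : ℕ)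

theorem growthPotential_anti (c : ℝ≥0∞) (n : ℕ) : Antitone (growthPotential c n) :=
  fun _ _ h => Finset.sum_le_sum_of_subset (Finset.Ico_subset_Ico_left h)

theorem growthPotential_eq_add (c : ℝ≥0∞) {n k : ℕ} (h : k < n) :
    growthPotential c n k = c / (min k (n - k) : ℕ) + growthPotential c n (k + 1) :=
  Finset.sum_eq_sum_Ico_succ_bot h _

theorem sum_one_div_min_le {n : ℕ} (hn : 2 ≤ n) :
    ∑ j ∈ Finset.Ico 1 n, (1 : ℝ) / (min j (n - j) : ℕ) ≤ 6 * Real.log n := by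
  have hterm : ∀ j ∈ Finset.Ico 1 n,
      (1 : ℝ) / (min j (n - j) : ℕ) ≤ (j : ℝ)⁻¹ + ((n - j : ℕ) : ℝ)⁻¹ := by
    intro j _
    rcases le_total j (n - j) with h | h
    · rw [min_eq_left h, one_div]
      exact le_add_of_nonneg_right (by positivity)
    · rw [min_eq_right h, one_div]
      exact le_add_of_nonneg_left (by positivity)
  have hharm : ∑ j ∈ Finset.Ico 1 n, (j : ℝ)⁻¹ ≤ 1 + Real.log n := by
    refine le_trans ?_ (harmonic_le_one_add_log n)
    rw [harmonic_eq_sum_Icc]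
    push_cast
    exact Finset.sum_le_sum_of_subset_of_nonneg
      (fun i hi => by simp only [Finset.mem_Ico, Finset.mem_Icc] at *; omega)
      fun i _ _ => by positivity
  have hrefl : ∑ j ∈ Finset.Ico 1 n, ((n - j : ℕ) : ℝ)⁻¹ = ∑ j ∈ Finset.Ico 1 n, (j : ℝ)⁻¹ :=
    Finset.sum_bij' (fun j _ => n - j) (fun j _ => n - j)
      (fun j hj => by simp only [Finset.mem_Ico] at *; omega)
      (fun j hj => by simp only [Finset.mem_Ico] at *; omega)
      (fun j hj => by simp only [Finset.mem_Ico] at *; omega)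
      (fun j hj => by simp only [Finset.mem_Ico] at *; omega)
      (fun j hj => rfl)
  have hsum := Finset.sum_le_sum hterm
  rw [Finset.sum_add_distrib, hrefl] at hsum
  have hlog : Real.log 2 ≤ Real.log n :=
    Real.log_le_log (by norm_num) (by exact_mod_cast hn)
  have := Real.log_two_gt_d9
  linarith

theorem growthPotential_le {n : ℕ} (hn : 2 ≤ n) {c : ℝ} (hc : 0 ≤ c) {k : ℕ} (hk : 1 ≤ k) :
    growthPotential (ENNReal.ofReal c) n k ≤ ENNReal.ofReal (c * (6 * Real.log n)) := by
  refine (growthPotential_anti _ n hk).trans ?_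
  have hterm : ∀ j ∈ Finset.Ico 1 n, ENNReal.ofReal c / (min j (n - j) : ℕ) =
      ENNReal.ofReal (c * (1 / (min j (n - j) : ℕ))) := by
    intro j hj
    have hpos : 0 < min j (n - j) := by
      simp only [Finset.mem_Ico] at hj
      omega
    rw [mul_one_div, ENNReal.ofReal_div_of_pos (by exact_mod_cast hpos), ENNReal.ofReal_natCast]
  rw [growthPotential, Finset.sum_congr rfl hterm,
    ← ENNReal.ofReal_sum_of_nonneg fun j _ => by positivity, ← Finset.mul_sum]
  exact ENNReal.ofReal_le_ofReal (mul_le_mul_of_nonneg_left (sum_one_div_min_le hn) hc)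

variable {V : Type*} [Fintype V] {E : V → V → Prop}

theorem growthPotential_drift (hV : 2 ≤ Fintype.card V)
    (hE : ∀ u v : V, Relation.ReflTransGen E u v) (g : V → ℕ) :
    (∑ v, growthPotential
        (ENNReal.ofReal (3 * (Fintype.card V / min (phiOut E) (phiIn E)))) (Fintype.card V)
        (strongCycleSet E (dUpdate E g v)).toFinset.card) * (1 / (Fintype.card V : ℝ≥0∞)) +
      (if strongCycleSet E g = Set.univ then 0 else 1) ≤
    growthPotential (ENNReal.ofReal (3 * (Fintype.card V / min (phiOut E) (phiIn E))))
      (Fintype.card V) (strongCycleSet E g).toFinset.card := by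
  set n := Fintype.card V with hn
  set φ := min (phiOut E) (phiIn E) with hφ
  have hφ0 : 0 < φ :=
    lt_min (phiOut_pos hV hE) (phiOut_pos hV fun u v => (hE v u).swap)
  have hn0 : (0 : ℝ) < n := by exact_mod_cast (by omega : 0 < n)
  set c := ENNReal.ofReal (3 * (n / φ)) with hc
  set A := (strongCycleSet E g).toFinset with hA
  set k := A.card with hk
  have hkn : k ≤ n := A.card_le_univ
  have hmono : ∀ v, growthPotential c n (strongCycleSet E (dUpdate E g v)).toFinset.card ≤
      growthPotential c n k := fun v =>
    growthPotential_anti c n (Finset.card_le_card (Set.toFinset_subset_toFinset.2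
      (Set.subset_union_left.trans (strongCycleSet_dUpdate v))))
  have hn0' : (n : ℝ≥0∞) ≠ 0 := by exact_mod_cast (by omega : n ≠ 0)
  have hntop : (n : ℝ≥0∞) ≠ ⊤ := ENNReal.natCast_ne_top n
  rw [mul_one_div]
  split_ifs with hfull
  · rw [add_zero, ENNReal.div_le_iff hn0' hntop, mul_comm]
    calc _ ≤ ∑ _v : V, growthPotential c n k := Finset.sum_le_sum fun v _ => hmono v
      _ = n * growthPotential c n k := by rw [Finset.sum_const, Finset.card_univ, nsmul_eq_mul]
  have hAuniv : A ≠ Finset.univ := fun h => hfull (by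
    rw [← Set.coe_toFinset (strongCycleSet E g), ← hA, h, Finset.coe_univ])
  have hklt : k < n := lt_of_le_of_ne hkn fun h => hAuniv ((Finset.card_eq_iff_eq_univ A).1 h)
  rw [growthPotential_eq_add c hklt] at hmono ⊢
  rcases Nat.eq_zero_or_pos k with hk0 | hkpos
  · have hc0 : c ≠ 0 := by
      rw [hc, Ne, ENNReal.ofReal_eq_zero, not_le]
      positivity
    simp [hk0, ENNReal.div_zero hc0]
  set d := c / (min k (n - k) : ℕ) with hd
  set Γ := outBoundary (fun a b => E b a) A with hΓ
  have hstep : ∀ v, growthPotential c n (strongCycleSet E (dUpdate E g v)).toFinset.card +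
      (if v ∈ Γ then d else 0) ≤ d + growthPotential c n (k + 1) := by
    intro v
    split_ifs with hv
    · rw [add_comm]
      gcongr
      refine growthPotential_anti c n ?_
      obtain ⟨hvA, u, hu, hvu⟩ := (Finset.mem_filter.1 hv).2
      rw [hk, ← Finset.card_insert_of_notMem hvA]
      refine Finset.card_le_card (Finset.insert_subset ?_ ?_)
      · rw [Set.mem_toFinset]
        exact strongCycleSet_dUpdate v (Or.inr ⟨rfl, u, Set.mem_toFinset.1 hu, hvu⟩)
      · exact Set.toFinset_subset_toFinset.2
          (Set.subset_union_left.trans (strongCycleSet_dUpdate v))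
    · rw [add_zero]
      exact hmono v
  have hgrow : (n : ℝ≥0∞) ≤ Γ.card * d := by
    have hmpos : 0 < min k (n - k) := by omega
    have hmpos' : (0 : ℝ) < (min k (n - k) : ℕ) := by exact_mod_cast hmpos
    have hmin := min_phi_mul_min_card_le (E := E) hV A
    rw [hd, hc, ← ENNReal.ofReal_natCast (min k (n - k)), ← ENNReal.ofReal_natCast n,
      ← ENNReal.ofReal_natCast Γ.card, ← ENNReal.ofReal_div_of_pos hmpos',
      ← ENNReal.ofReal_mul (by positivity)]
    refine ENNReal.ofReal_le_ofReal ?_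
    rw [mul_div_assoc', le_div_iff₀ hmpos', mul_div_assoc', mul_div_assoc', le_div_iff₀ hφ0]
    calc (n : ℝ) * (min k (n - k) : ℕ) * φ = n * (φ * (min k (n - k) : ℕ)) := by ring
      _ ≤ n * (3 * Γ.card) := by gcongr
      _ = _ := by ring
  refine (ENNReal.mul_le_mul_iff_left hn0' hntop).1 ?_
  rw [add_mul, ENNReal.div_mul_cancel hn0' hntop, one_mul]
  calc _ ≤ ∑ v, growthPotential c n (strongCycleSet E (dUpdate E g v)).toFinset.card +
        Γ.card * d := by gcongr
    _ = ∑ v, (growthPotential c n (strongCycleSet E (dUpdate E g v)).toFinset.card +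
        (if v ∈ Γ then d else 0)) := by
      rw [Finset.sum_add_distrib, Finset.sum_ite_mem, Finset.univ_inter, Finset.sum_const,
        nsmul_eq_mul]
    _ ≤ ∑ _v : V, (d + growthPotential c n (k + 1)) := Finset.sum_le_sum fun v _ => hstep v
    _ = _ := by rw [Finset.sum_const, Finset.card_univ, nsmul_eq_mul, mul_comm]

end Potential

/-- there is a constant `C > 0` such that for every finite strongly connected
directed graph on `n ≥ 2` vertices with `φ' = min(φ_out, φ_in)` and every valuation
`f : V → {1,…,n}` whose strong cycle set is nonempty, the expected number of rounds of the
asynchronous maximum model started from `f` until the strong cycle set equals all of `V` is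
at most `C·(n/φ')·log n`. -/
theorem expected_fullCycleSetTime_le :
    ∃ C : ℝ, 0 < C ∧
      ∀ (V : Type) [Fintype V] [MeasurableSpace V] [MeasurableSingletonClass V]
        (E : V → V → Prop) (n : ℕ), 2 ≤ n → Fintype.card V = n →
        (∀ u v : V, Relation.ReflTransGen E u v) →
        ∀ (f : V → ℕ), (∀ v, f v ∈ Finset.Icc 1 n) →
        (strongCycleSet E f).Nonempty →
        ∀ (μ : Measure (ℕ → V)), IsUniformProduct μ →
          ∫⁻ ω, fullCycleSetTime E f ω ∂μ ≤
            ENNReal.ofReal (C * ((n : ℝ) / min (phiOut E) (phiIn E)) * Real.log n) := by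
  refine ⟨18, by norm_num, ?_⟩
  intro V _ _ _ E n hn hcard hE f _ hne μ hμ
  subst hcard
  have : Nonempty V := ⟨hne.some⟩
  refine (lintegral_fullCycleSetTime_le_of_drift hμ
    (fun g => growthPotential
      (ENNReal.ofReal (3 * (Fintype.card V / min (phiOut E) (phiIn E)))) (Fintype.card V)
      (strongCycleSet E g).toFinset.card) (growthPotential_drift hn hE) f).trans ?_
  have hφ : 0 ≤ min (phiOut E) (phiIn E) := le_min phiOut_nonneg phiOut_nonneg
  refine (growthPotential_le hn (by positivity) ?_).trans (le_of_eq ?_)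
  · exact Finset.card_pos.2 (Set.toFinset_nonempty.2 hne)
  · congr 1
    ring
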